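/- (Surface transport theorem) Let f : ℝ³ × ℝ → ℝ be C¹. For every Lebesgue-measurable V ⊆ U, setting Ω(t) = x̂(V × {t}), the function t ↦ ∫_{Ω(t)} f(x,t) dH²(x) is differentiable on (0,T) and (d/dt) ∫_{Ω(t)} f(x,t) dH²(x) = ∫_{Ω(t)} ( D_t f + (div_Γ v) f )(x,t) dH²(x). -/

import Mathlib

noncomputable section
open MeasureTheory

/-- ℝ² with the Euclidean structure. -/
abbrev E2 : Type := EuclideanSpace ℝ (Fin 2)
/-- ℝ³ with the Euclidean structure. -/
abbrev E3 : Type := EuclideanSpace ℝ (Fin 3)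

/-- The cross product on ℝ³. -/
def cross3 (a b : E3) : E3 :=
  (EuclideanSpace.equiv (Fin 3) ℝ).symm
    ![a 1 * b 2 - a 2 * b 1, a 2 * b 0 - a 0 * b 2, a 0 * b 1 - a 1 * b 0]

/-- The dot product on ℝ³. -/
def dot3 (a b : E3) : ℝ := ∑ i, a i * b i

/-- The tangent vector `g_α = ∂x̂/∂X_α` of the parametrization `x̂` at `(X, t)`. -/
def gVec (xh : E2 × ℝ → E3) (α : Fin 2) (X : E2) (t : ℝ) : E3 :=
  fderiv ℝ (fun Y : E2 => xh (Y, t)) X (EuclideanSpace.single α 1)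

/-- The Riemannian metric `g_{αβ} = g_α · g_β`. -/
def gMet (xh : E2 × ℝ → E3) (α β : Fin 2) (X : E2) (t : ℝ) : ℝ :=
  dot3 (gVec xh α X t) (gVec xh β X t)

/-- The Gram determinant `G = g₁₁ g₂₂ − g₁₂ g₂₁`. -/
def Gdet (xh : E2 × ℝ → E3) (X : E2) (t : ℝ) : ℝ :=
  gMet xh 0 0 X t * gMet xh 1 1 X t - gMet xh 0 1 X t * gMet xh 1 0 X t

/-- The inverse metric `(g^{αβ}) = (g_{αβ})⁻¹`. -/
def gInv (xh : E2 × ℝ → E3) (X : E2) (t : ℝ) : Matrix (Fin 2) (Fin 2) ℝ :=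
  (Matrix.of fun α β => gMet xh α β X t)⁻¹

/-- The raised tangent vector `g^α = Σ_β g^{αβ} g_β`. -/
def gVecUp (xh : E2 × ℝ → E3) (α : Fin 2) (X : E2) (t : ℝ) : E3 :=
  ∑ β, gInv xh X t α β • gVec xh β X t

/-- The unit normal `n̂ = (g₁ × g₂)/|g₁ × g₂|` of the parametrized surface. -/
def nHat (xh : E2 × ℝ → E3) (X : E2) (t : ℝ) : E3 :=
  ‖cross3 (gVec xh 0 X t) (gVec xh 1 X t)‖⁻¹ • cross3 (gVec xh 0 X t) (gVec xh 1 X t)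

/-- Spatial partial derivative `∂f/∂x_j` at `(x, t)`. -/
def pdx (j : Fin 3) (f : E3 × ℝ → ℝ) (x : E3) (t : ℝ) : ℝ :=
  fderiv ℝ (fun y : E3 => f (y, t)) x (EuclideanSpace.single j 1)

/-- Time partial derivative `∂f/∂t` at `(x, t)`. -/
def pdt (f : E3 × ℝ → ℝ) (x : E3) (t : ℝ) : ℝ := deriv (fun s => f (x, s)) t

/-- Tangential derivative `∂_j^Γ f = Σ_i (δ_{ij} − N_i N_j) ∂f/∂x_i`
with normal extension `N`. -/
def tder (N : E3 × ℝ → E3) (j : Fin 3) (f : E3 × ℝ → ℝ) (x : E3) (t : ℝ) : ℝ :=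
  ∑ i, ((if i = j then (1 : ℝ) else 0) - N (x, t) i * N (x, t) j) * pdx i f x t

/-- Surface gradient `grad_Γ f = (∂_1^Γ f, ∂_2^Γ f, ∂_3^Γ f)`. -/
def sgrad (N : E3 × ℝ → E3) (f : E3 × ℝ → ℝ) (x : E3) (t : ℝ) : E3 :=
  (EuclideanSpace.equiv (Fin 3) ℝ).symm fun j => tder N j f x t

/-- Surface divergence `div_Γ φ = Σ_j ∂_j^Γ φ_j`. -/
def sdiv (N : E3 × ℝ → E3) (φ : E3 × ℝ → E3) (x : E3) (t : ℝ) : ℝ :=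
  ∑ j, tder N j (fun p => φ p j) x t

/-- Row-wise surface divergence of a matrix field: `(div_Γ M)_i = Σ_j ∂_j^Γ M_{ij}`. -/
def sdivM (N : E3 × ℝ → E3) (M : E3 × ℝ → Matrix (Fin 3) (Fin 3) ℝ) (x : E3) (t : ℝ) : E3 :=
  (EuclideanSpace.equiv (Fin 3) ℝ).symm fun i => ∑ j, tder N j (fun p => M p i j) x t

/-- The orthogonal projection matrix `P_Γ = I − N ⊗ N`. -/
def Pmat (N : E3 × ℝ → E3) (x : E3) (t : ℝ) : Matrix (Fin 3) (Fin 3) ℝ :=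
  Matrix.of fun i j => (if i = j then (1 : ℝ) else 0) - N (x, t) i * N (x, t) j

/-- The symmetric gradient `D(φ) = ((∇φ) + (∇φ)ᵀ)/2`. -/
def Dmat (φ : E3 × ℝ → E3) (x : E3) (t : ℝ) : Matrix (Fin 3) (Fin 3) ℝ :=
  Matrix.of fun i j => (pdx i (fun p => φ p j) x t + pdx j (fun p => φ p i) x t) / 2

/-- The surface stretching tensor `D_Γ(φ) = P_Γ D(φ) P_Γ`. -/
def DGam (N : E3 × ℝ → E3) (φ : E3 × ℝ → E3) (x : E3) (t : ℝ) : Matrix (Fin 3) (Fin 3) ℝ :=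
  Pmat N x t * Dmat φ x t * Pmat N x t

/-- The squared Frobenius norm `|M|² = Σ_{i,j} M_{ij}²`. -/
def frob2 (M : Matrix (Fin 3) (Fin 3) ℝ) : ℝ := ∑ i, ∑ j, (M i j) ^ 2

/-- The material derivative `D_t f = ∂_t f + (v · ∇)f`. -/
def Dt (v : E3 × ℝ → E3) (f : E3 × ℝ → ℝ) (x : E3) (t : ℝ) : ℝ :=
  pdt f x t + ∑ i, v (x, t) i * pdx i f x t

/-- Matrix-vector product on ℝ³. -/
def mulVec3 (M : Matrix (Fin 3) (Fin 3) ℝ) (w : E3) : E3 :=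
  (EuclideanSpace.equiv (Fin 3) ℝ).symm (M.mulVec fun i => w i)

section AreaFormula

open Set Filter Topology Module
open scoped NNReal ENNReal

theorem hausdorffMeasure_image_le_of_edist_le {X Y Z : Type*}
    [EMetricSpace Y] [MeasurableSpace Y] [BorelSpace Y]
    [EMetricSpace Z] [MeasurableSpace Z] [BorelSpace Z]
    {a : X → Y} {b : X → Z} {S : Set X} {K : ℝ≥0} {d : ℝ} (hd : 0 ≤ d)
    (h : ∀ x ∈ S, ∀ y ∈ S, edist (b x) (b y) ≤ K * edist (a x) (a y)) :
    μH[d] (b '' S) ≤ (K : ℝ≥0∞) ^ d * μH[d] (a '' S) := by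
  rcases S.eq_empty_or_nonempty with rfl | ⟨x₀, -⟩
  · simp
  have : Nonempty X := ⟨x₀⟩
  have hinv : ∀ x ∈ S, Function.invFunOn a S (a x) ∈ S ∧ a (Function.invFunOn a S (a x)) = a x :=
    fun x hx => ⟨Function.invFunOn_mem ⟨x, hx, rfl⟩, Function.invFunOn_eq ⟨x, hx, rfl⟩⟩
  have hlip : LipschitzOnWith K (fun y => b (Function.invFunOn a S y)) (a '' S) := by
    rintro _ ⟨x, hx, rfl⟩ _ ⟨y, hy, rfl⟩
    have := h _ (hinv x hx).1 _ (hinv y hy).1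
    rwa [(hinv x hx).2, (hinv y hy).2] at this
  have heq : b '' S = (fun y => b (Function.invFunOn a S y)) '' (a '' S) := by
    rw [image_image]
    refine image_congr fun x hx => ?_
    have := h _ hx _ (hinv x hx).1
    rw [(hinv x hx).2, edist_self, mul_zero] at this
    exact edist_le_zero.1 this
  rw [heq]
  exact hlip.hausdorffMeasure_image_le hd

variable {E F : Type*} [NormedAddCommGroup E] [InnerProductSpace ℝ E] [FiniteDimensional ℝ E]
  [NormedAddCommGroup F] [InnerProductSpace ℝ F]

theorem HasStrictFDerivAt.eventually_edist_le_edist {φ : E → F} {A : E →L[ℝ] F} {x : E}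
    (hφ : HasStrictFDerivAt φ A x) (hA : Function.Injective A) {K : ℝ≥0} (hK : 1 < K) :
    ∃ s ∈ 𝓝 x, ∀ y ∈ s, ∀ z ∈ s, edist (φ y) (φ z) ≤ K * edist (A y) (A z) ∧
      edist (A y) (A z) ≤ K * edist (φ y) (φ z) := by
  obtain ⟨k, hk, hanti⟩ :=
    LinearMap.exists_antilipschitzWith (A : E →ₗ[ℝ] F) (LinearMap.ker_eq_bot.2 hA)
  have hK' : (1 : ℝ) < K := by exact_mod_cast hK
  have hK0 : (0 : ℝ) < K := by linarith
  have hk' : (0 : ℝ) < k := by exact_mod_cast hk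
  obtain ⟨ε, hε, hεk⟩ : ∃ ε : ℝ≥0, 0 < ε ∧ (ε * k : ℝ) = 1 - (K : ℝ)⁻¹ := by
    have h1 : 0 < (1 - (K : ℝ)⁻¹) / k := by
      have := inv_lt_one_of_one_lt₀ hK'
      apply div_pos _ hk'
      linarith
    refine ⟨⟨_, h1.le⟩, h1, ?_⟩
    change (1 - (K : ℝ)⁻¹) / k * k = _
    field_simp
  obtain ⟨s, hs, happ⟩ := hφ.approximates_deriv_on_nhds (Or.inr hε)
  refine ⟨s, hs, fun y hy z hz => ?_⟩
  have h1 : ‖φ y - φ z - A (y - z)‖ ≤ ε * ‖y - z‖ := happ y hy z hz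
  have h2 : ‖y - z‖ ≤ k * ‖A (y - z)‖ := by
    have := hanti.le_mul_dist y z
    simpa [dist_eq_norm] using this
  have h3 : ‖φ y - φ z - A (y - z)‖ ≤ (1 - (K : ℝ)⁻¹) * ‖A (y - z)‖ := by
    rw [← hεk, mul_assoc]
    exact h1.trans (by gcongr)
  have h4 : ‖φ y - φ z‖ ≤ ‖A (y - z)‖ + ‖φ y - φ z - A (y - z)‖ := by
    simpa using norm_add_le (A (y - z)) (φ y - φ z - A (y - z))
  have h5 : ‖A (y - z)‖ ≤ ‖φ y - φ z‖ + ‖φ y - φ z - A (y - z)‖ := by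
    simpa using norm_sub_le (φ y - φ z) (φ y - φ z - A (y - z))
  have h6 : (1 : ℝ) + (1 - (K : ℝ)⁻¹) ≤ K := by
    have : (K : ℝ) - (1 + (1 - (K : ℝ)⁻¹)) = (K - 1) ^ 2 / K := by field_simp; ring
    have : 0 ≤ ((K : ℝ) - 1) ^ 2 / K := by positivity
    linarith
  have hmul {Y : Type _} [SeminormedAddCommGroup Y] {Z : Type _} [SeminormedAddCommGroup Z]
      {p q : Y} {r t : Z} (h : ‖p - q‖ ≤ K * ‖r - t‖) : edist p q ≤ K * edist r t := by
    rw [edist_nndist, edist_nndist, ← ENNReal.coe_mul, ENNReal.coe_le_coe, ← NNReal.coe_le_coe]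
    simpa [dist_eq_norm] using h
  constructor
  · refine hmul ?_
    rw [← map_sub]
    nlinarith [norm_nonneg (A (y - z))]
  · refine hmul ?_
    rw [← map_sub]
    have : (K : ℝ)⁻¹ * ‖A (y - z)‖ ≤ ‖φ y - φ z‖ := by linarith
    calc ‖A (y - z)‖ = K * ((K : ℝ)⁻¹ * ‖A (y - z)‖) := by field_simp
      _ ≤ _ := by gcongr

theorem continuous_normDet : Continuous fun A : E →L[ℝ] F => (A : E →ₗ[ℝ] F).normDet := by
  have h : (fun A : E →L[ℝ] F => (A : E →ₗ[ℝ] F).normDet) = fun A : E →L[ℝ] F =>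
      √(Matrix.gram ℝ fun i => A (stdOrthonormalBasis ℝ E i)).det := by
    ext A
    have := (A : E →ₗ[ℝ] F).normDet_sq_eq_det_gram (stdOrthonormalBasis ℝ E)
    rw [← Real.sqrt_sq (LinearMap.normDet_nonneg (A : E →ₗ[ℝ] F))]
    exact congrArg Real.sqrt this
  rw [h]
  refine Real.continuous_sqrt.comp (Continuous.matrix_det ?_)
  refine continuous_matrix fun i j => ?_
  simp only [Matrix.gram_apply]
  fun_prop

variable [MeasurableSpace E] [BorelSpace E] [MeasurableSpace F] [BorelSpace F]

/-- At a point where `φ` is strictly differentiable with injective derivative `A`, the Hausdorff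
measure of images of small balls is asymptotically scaled by `A.normDet`. -/
theorem HasStrictFDerivAt.tendsto_hausdorffMeasure_image_closedBall_div {φ : E → F} {A : E →L[ℝ] F}
    {x : E} (hφ : HasStrictFDerivAt φ A x) (hA : Function.Injective A) :
    Tendsto (fun r => μH[finrank ℝ E] (φ '' Metric.closedBall x r) /
        μH[finrank ℝ E] (Metric.closedBall x r)) (𝓝[>] 0)
      (𝓝 (ENNReal.ofReal (A : E →ₗ[ℝ] F).normDet)) := by
  set J := ENNReal.ofReal (A : E →ₗ[ℝ] F).normDet with hJ
  set d := finrank ℝ E with hd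
  have hpow : Tendsto (fun K : ℝ≥0 => (K : ℝ≥0∞) ^ (d : ℝ)) (𝓝[>] 1) (𝓝 1) := by
    have h : Tendsto (fun K : ℝ≥0 => (K : ℝ≥0∞) ^ (d : ℝ)) (𝓝 1) (𝓝 (((1 : ℝ≥0) : ℝ≥0∞) ^ (d : ℝ))) :=
      ((ENNReal.continuous_rpow_const (y := (d : ℝ))).comp ENNReal.continuous_coe).tendsto 1
    simp only [ENNReal.coe_one, ENNReal.one_rpow] at h
    exact h.mono_left nhdsWithin_le_nhds
  have hupper : Tendsto (fun K : ℝ≥0 => (K : ℝ≥0∞) ^ (d : ℝ) * J) (𝓝[>] 1) (𝓝 J) := by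
    simpa using ENNReal.Tendsto.mul_const hpow (Or.inl one_ne_zero)
  have hlower : Tendsto (fun K : ℝ≥0 => ((K : ℝ≥0∞) ^ (d : ℝ))⁻¹ * J) (𝓝[>] 1) (𝓝 J) := by
    simpa using ENNReal.Tendsto.mul_const (tendsto_inv_iff.2 hpow) (Or.inl (by simp))
  have key : ∀ K : ℝ≥0, 1 < K → ∀ᶠ r in 𝓝[>] (0 : ℝ),
      μH[d] (φ '' Metric.closedBall x r) / μH[d] (Metric.closedBall x r) ≤ (K : ℝ≥0∞) ^ (d : ℝ) * J ∧
      ((K : ℝ≥0∞) ^ (d : ℝ))⁻¹ * J ≤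
        μH[d] (φ '' Metric.closedBall x r) / μH[d] (Metric.closedBall x r) := by
    intro K hK
    obtain ⟨s, hs, hsK⟩ := hφ.eventually_edist_le_edist hA hK
    obtain ⟨R, hR, hRs⟩ := Metric.nhds_basis_closedBall.mem_iff.1 hs
    filter_upwards [Ioc_mem_nhdsGT hR] with r hr
    have hrs : Metric.closedBall x r ⊆ s := (Metric.closedBall_subset_closedBall hr.2).trans hRs
    have hpos : μH[d] (Metric.closedBall x r) ≠ 0 :=
      (Metric.measure_closedBall_pos _ x hr.1).ne'
    have hfin : μH[d] (Metric.closedBall x r) ≠ ∞ := measure_closedBall_lt_top.ne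
    have hlin : μH[d] (A '' Metric.closedBall x r) = J * μH[d] (Metric.closedBall x r) :=
      (A : E →ₗ[ℝ] F).hausdorffMeasure_image _
    have hKd : (K : ℝ≥0∞) ^ (d : ℝ) ≠ 0 := by
      simp [(zero_lt_one.trans hK).ne']
    have hKd' : (K : ℝ≥0∞) ^ (d : ℝ) ≠ ∞ := ENNReal.rpow_ne_top_of_nonneg (by positivity) (by simp)
    have h1 := hausdorffMeasure_image_le_of_edist_le (d := d) (Nat.cast_nonneg _)
      fun y hy z hz => (hsK y (hrs hy) z (hrs hz)).1
    have h2 := hausdorffMeasure_image_le_of_edist_le (d := d) (Nat.cast_nonneg _)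
      fun y hy z hz => (hsK y (hrs hy) z (hrs hz)).2
    rw [hlin] at h1 h2
    constructor
    · rw [ENNReal.div_le_iff hpos hfin, mul_assoc]
      exact h1
    · rw [ENNReal.le_div_iff_mul_le (Or.inl hpos) (Or.inl hfin), mul_assoc,
        ENNReal.inv_mul_le_iff hKd hKd']
      exact h2
  refine tendsto_order.2 ⟨fun a ha => ?_, fun a ha => ?_⟩
  · obtain ⟨K, hKa, hK⟩ := ((hlower.eventually_const_lt ha).and self_mem_nhdsWithin).exists
    filter_upwards [key K hK] with r hr using hKa.trans_le hr.2
  · obtain ⟨K, hKa, hK⟩ := ((hupper.eventually_lt_const ha).and self_mem_nhdsWithin).exists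
    filter_upwards [key K hK] with r hr using hr.1.trans_lt hKa

/-- **Area formula** for the measure of images under injective `C¹` immersions. -/
theorem hausdorffMeasure_image_eq_lintegral_normDet {φ : E → F} (hφ : ContDiff ℝ 1 φ)
    {s : Set E} (hs : IsOpen s) (hinj : InjOn φ s)
    (himm : ∀ x ∈ s, Function.Injective (fderiv ℝ φ x)) {t : Set E} (ht : MeasurableSet t)
    (hts : t ⊆ s) :
    μH[finrank ℝ E] (φ '' t) = ∫⁻ x in t, ENNReal.ofReal
      (fderiv ℝ φ x : E →ₗ[ℝ] F).normDet ∂(μH[finrank ℝ E] : Measure E) := by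
  set d := finrank ℝ E with hd
  have hemb : MeasurableEmbedding (s.domRestrict φ) :=
    hφ.continuous.continuousOn.measurableEmbedding hs.measurableSet hinj
  let ν : Measure E := (μH[d].comap (s.domRestrict φ)).map Subtype.val
  have hν : ∀ u, MeasurableSet u → ν u = μH[d] (φ '' (u ∩ s)) := by
    intro u hu
    rw [Measure.map_apply measurable_subtype_coe hu, hemb.comap_apply, Set.domRestrict_eq,
      image_comp, Subtype.image_preimage_coe, inter_comm]
  have hloc : ∀ x : E, ∃ K : ℝ≥0, ∃ u, IsOpen u ∧ x ∈ u ∧ ∀ w ⊆ u, MeasurableSet w →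
      ν w ≤ (K : ℝ≥0∞) ^ (d : ℝ) * μH[d] w := by
    intro x
    obtain ⟨K, u, hu, hlip⟩ := hφ.contDiffAt.exists_lipschitzOnWith (x := x)
    obtain ⟨o, hou, ho, hxo⟩ := mem_nhds_iff.1 hu
    refine ⟨K, o, ho, hxo, fun w hw hwm => ?_⟩
    rw [hν w hwm]
    refine ((hlip.mono ((inter_subset_left.trans hw).trans hou)).hausdorffMeasure_image_le
      (Nat.cast_nonneg _)).trans ?_
    gcongr
    exact inter_subset_left
  have hfin : IsLocallyFiniteMeasure ν := by
    refine ⟨fun x => ?_⟩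
    obtain ⟨K, u, hu, hxu, h⟩ := hloc x
    refine ⟨u ∩ Metric.ball x 1, (hu.inter Metric.isOpen_ball).mem_nhds
      ⟨hxu, Metric.mem_ball_self one_pos⟩, ?_⟩
    refine (h _ inter_subset_left (hu.inter Metric.isOpen_ball).measurableSet).trans_lt ?_
    refine ENNReal.mul_lt_top (ENNReal.rpow_lt_top_of_nonneg (by positivity) (by simp)) ?_
    exact (measure_mono inter_subset_right).trans_lt measure_ball_lt_top
  have hac : ν ≪ μH[d] := by
    refine Measure.AbsolutelyContinuous.mk fun w hw hw0 => ?_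
    refine measure_null_of_locally_null w fun x _ => ?_
    obtain ⟨K, u, hu, hxu, h⟩ := hloc x
    refine ⟨w ∩ u, inter_mem self_mem_nhdsWithin (mem_nhdsWithin_of_mem_nhds (hu.mem_nhds hxu)), ?_⟩
    have := h (w ∩ u) inter_subset_right (hw.inter hu.measurableSet)
    rwa [measure_mono_null inter_subset_left hw0, mul_zero, nonpos_iff_eq_zero] at this
  rw [← inter_eq_self_of_subset_left hts, ← hν t ht, inter_eq_self_of_subset_left hts,
    ← Measure.setLIntegral_rnDeriv' hac ht]
  refine setLIntegral_congr_fun_ae ht ?_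
  filter_upwards [Besicovitch.ae_tendsto_rnDeriv ν μH[d]] with x hx hxt
  have hxs := hts hxt
  have h := ((hφ.contDiffAt (x := x)).hasStrictFDerivAt
    one_ne_zero).tendsto_hausdorffMeasure_image_closedBall_div (himm x hxs)
  refine tendsto_nhds_unique hx (h.congr' ?_)
  obtain ⟨R, hR, hRs⟩ := Metric.nhds_basis_closedBall.mem_iff.1 (hs.mem_nhds hxs)
  filter_upwards [Ioc_mem_nhdsGT hR] with r hr
  rw [hν _ Metric.isClosed_closedBall.measurableSet, inter_eq_self_of_subset_left
    ((Metric.closedBall_subset_closedBall hr.2).trans hRs)]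

/-- **Area formula** for integrals over images of injective `C¹` immersions. -/
theorem setIntegral_image_hausdorffMeasure_eq {G : Type*} [NormedAddCommGroup G] [NormedSpace ℝ G]
    {φ : E → F} (hφ : ContDiff ℝ 1 φ)
    {s : Set E} (hs : IsOpen s) (hinj : InjOn φ s)
    (himm : ∀ x ∈ s, Function.Injective (fderiv ℝ φ x)) {t : Set E} (ht : MeasurableSet t)
    (hts : t ⊆ s) (g : F → G) :
    ∫ y in φ '' t, g y ∂(μH[finrank ℝ E] : Measure F) =
      ∫ x in t, (fderiv ℝ φ x : E →ₗ[ℝ] F).normDet • g (φ x) ∂(μH[finrank ℝ E] : Measure E) := by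
  have hemb : MeasurableEmbedding (t.domRestrict φ) :=
    hφ.continuous.continuousOn.measurableEmbedding ht (hinj.mono hts)
  have hmeas : Measurable fun x => (fderiv ℝ φ x : E →ₗ[ℝ] F).normDet :=
    (continuous_normDet.comp (hφ.continuous_fderiv one_ne_zero)).measurable
  have hcomap : (μH[finrank ℝ E] : Measure F).comap (t.domRestrict φ) =
      (μH[finrank ℝ E].withDensity fun x =>
        ENNReal.ofReal (fderiv ℝ φ x : E →ₗ[ℝ] F).normDet).comap ((↑) : t → E) := by
    ext u hu
    have hu' := (MeasurableEmbedding.subtype_coe ht).measurableSet_image.2 hu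
    rw [hemb.comap_apply, (MeasurableEmbedding.subtype_coe ht).comap_apply,
      withDensity_apply _ hu', Set.domRestrict_eq, image_comp]
    exact hausdorffMeasure_image_eq_lintegral_normDet hφ hs hinj himm hu'
      ((Subtype.coe_image_subset t u).trans hts)
  have hrange : φ '' t = range (t.domRestrict φ) := by simp
  rw [hrange, ← hemb.map_comap, hemb.integral_map, hcomap]
  simp only [Set.domRestrict_apply, ← Function.comp_apply (f := g), ENNReal.ofReal]
  rw [← (MeasurableEmbedding.subtype_coe ht).integral_map (g := fun x => (g ∘ φ) x),
    map_comap_subtype_coe ht,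
    setIntegral_withDensity_eq_setIntegral_smul₀ hmeas.real_toNNReal.aemeasurable _ ht]
  congr with x
  rw [NNReal.smul_def, Real.coe_toNNReal _ (LinearMap.normDet_nonneg _)]

end AreaFormula

section SurfaceCalculus

open Filter Topology
open Set (InjOn)

theorem dot3_eq_inner (a b : E3) : dot3 a b = inner ℝ a b := by
  simp [dot3, PiLp.inner_apply, mul_comm]

theorem sqrt_Gdet_eq_normDet (xh : E2 × ℝ → E3) (X : E2) (t : ℝ) :
    √(Gdet xh X t) = (fderiv ℝ (fun Y : E2 => xh (Y, t)) X : E2 →ₗ[ℝ] E3).normDet := by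
  have h := (fderiv ℝ (fun Y : E2 => xh (Y, t)) X : E2 →ₗ[ℝ] E3).normDet_sq_eq_det_gram
    (EuclideanSpace.basisFun (Fin 2) ℝ)
  rw [← Real.sqrt_sq (LinearMap.normDet_nonneg _)]
  refine congrArg Real.sqrt (Eq.trans ?_ h.symm)
  simp [Gdet, gMet, dot3_eq_inner, gVec, Matrix.det_fin_two, Matrix.gram_apply]

theorem hausdorffMeasure_two_isAddHaarMeasure :
    (μH[2] : Measure E2).IsAddHaarMeasure := by
  simpa using MeasureTheory.isAddHaarMeasure_hausdorffMeasure (E := E2)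

theorem surface_integral_eq {xh : E2 × ℝ → E3} (hxh : ContDiff ℝ 2 xh) {U V : Set E2}
    (hU : IsOpen U) (hV : MeasurableSet V) (hVU : V ⊆ U) {t : ℝ}
    (hG : ∀ X ∈ U, 0 < Gdet xh X t) (hinj : InjOn (fun X => xh (X, t)) U) (g : E3 → ℝ) :
    ∫ x in (fun X => xh (X, t)) '' V, g x ∂(μH[2] : Measure E3) =
      ∫ X in V, √(Gdet xh X t) * g (xh (X, t)) ∂(μH[2] : Measure E2) := by
  have hφ : ContDiff ℝ 1 fun X => xh (X, t) :=
    (hxh.of_le one_le_two).comp (contDiff_id.prodMk contDiff_const)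
  have himm : ∀ X ∈ U, Function.Injective (fderiv ℝ (fun X => xh (X, t)) X) := by
    intro X hX
    refine ((LinearMap.normDet_ne_zero_tfae
      (fderiv ℝ (fun Y : E2 => xh (Y, t)) X : E2 →ₗ[ℝ] E3)).out 0 4).1 ?_
    rw [← sqrt_Gdet_eq_normDet]
    exact (Real.sqrt_pos.2 (hG X hX)).ne'
  have h := setIntegral_image_hausdorffMeasure_eq hφ hU hinj himm hV hVU g
  simpa [sqrt_Gdet_eq_normDet] using h

theorem hasFDerivAt_slice {E F G : Type*} [NormedAddCommGroup E] [NormedSpace ℝ E]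
    [NormedAddCommGroup F] [NormedSpace ℝ F] [NormedAddCommGroup G] [NormedSpace ℝ G]
    {h : E × F → G} {x : E} {t : F} (hd : DifferentiableAt ℝ h (x, t)) :
    HasFDerivAt (fun y => h (y, t)) (fderiv ℝ h (x, t) ∘L ContinuousLinearMap.inl ℝ E F) x :=
  hd.hasFDerivAt.comp x (hasFDerivAt_prodMk_left x t)

theorem hasDerivAt_time_slice {E G : Type*} [NormedAddCommGroup E] [NormedSpace ℝ E]
    [NormedAddCommGroup G] [NormedSpace ℝ G]
    {h : E × ℝ → G} {x : E} {t : ℝ} (hd : DifferentiableAt ℝ h (x, t)) :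
    HasDerivAt (fun s => h (x, s)) (fderiv ℝ h (x, t) (0, 1)) t :=
  hd.hasFDerivAt.comp_hasDerivAt t ((hasDerivAt_const t x).prodMk (hasDerivAt_id t))

theorem gVec_eq {xh : E2 × ℝ → E3} (hxh : Differentiable ℝ xh) (α : Fin 2) (X : E2) (t : ℝ) :
    gVec xh α X t = fderiv ℝ xh (X, t) (EuclideanSpace.single α 1, 0) := by
  simp [gVec, (hasFDerivAt_slice (hxh (X, t))).fderiv]

theorem pdx_eq {f : E3 × ℝ → ℝ} (hf : Differentiable ℝ f) (j : Fin 3) (x : E3) (t : ℝ) :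
    pdx j f x t = fderiv ℝ f (x, t) (EuclideanSpace.single j 1, 0) := by
  simp [pdx, (hasFDerivAt_slice (hf (x, t))).fderiv]

theorem pdt_eq {f : E3 × ℝ → ℝ} (hf : Differentiable ℝ f) (x : E3) (t : ℝ) :
    pdt f x t = fderiv ℝ f (x, t) (0, 1) :=
  (hasDerivAt_time_slice (hf (x, t))).deriv

theorem continuous_fderiv_apply_of_contDiff {E G : Type*} [NormedAddCommGroup E] [NormedSpace ℝ E]
    [NormedAddCommGroup G] [NormedSpace ℝ G] {h : E → G} (hh : ContDiff ℝ 1 h) (w : E) :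
    Continuous fun p => fderiv ℝ h p w :=
  (hh.continuous_fderiv one_ne_zero).clm_apply continuous_const

theorem continuous_Gdet {xh : E2 × ℝ → E3} (hxh : ContDiff ℝ 1 xh) :
    Continuous fun p : E2 × ℝ => Gdet xh p.1 p.2 := by
  have h : ∀ α, Continuous fun p : E2 × ℝ => gVec xh α p.1 p.2 := fun α => by
    simp only [gVec_eq (hxh.differentiable one_ne_zero)]
    exact continuous_fderiv_apply_of_contDiff hxh _
  simp only [Gdet, gMet, dot3_eq_inner]
  have h0 := h 0
  have h1 := h 1
  fun_prop

theorem continuous_pdx {f : E3 × ℝ → ℝ} (hf : ContDiff ℝ 1 f) (j : Fin 3) :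
    Continuous fun p : E3 × ℝ => pdx j f p.1 p.2 := by
  simp only [pdx_eq (hf.differentiable one_ne_zero)]
  exact continuous_fderiv_apply_of_contDiff hf _

theorem continuous_Dt {v : E3 × ℝ → E3} (hv : Continuous v) {f : E3 × ℝ → ℝ}
    (hf : ContDiff ℝ 1 f) : Continuous fun p : E3 × ℝ => Dt v f p.1 p.2 := by
  have h := continuous_pdx hf
  have h' : Continuous fun p : E3 × ℝ => pdt f p.1 p.2 := by
    simp only [pdt_eq (hf.differentiable one_ne_zero)]
    exact continuous_fderiv_apply_of_contDiff hf _
  simp only [Dt]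
  fun_prop

theorem continuous_sdiv {N v : E3 × ℝ → E3} (hN : Continuous N) (hv : ContDiff ℝ 1 v) :
    Continuous fun p : E3 × ℝ => sdiv N v p.1 p.2 := by
  have h : ∀ i j : Fin 3, Continuous fun p : E3 × ℝ => pdx i (fun q => v q j) p.1 p.2 :=
    fun i j => continuous_pdx (contDiff_euclidean.1 hv j) i
  simp only [sdiv, tder]
  fun_prop

/-- The time derivative of a tangent vector is the derivative of the velocity along it. -/
theorem hasDerivAt_gVec {xh : E2 × ℝ → E3} (hxh : ContDiff ℝ 2 xh) {v : E3 × ℝ → E3}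
    (hv : ContDiff ℝ 1 v) {X : E2} {t : ℝ}
    (hflow : ∀ᶠ Y in 𝓝 X, deriv (fun s => xh (Y, s)) t = v (xh (Y, t), t)) (α : Fin 2) :
    HasDerivAt (fun s => gVec xh α X s)
      (fderiv ℝ (fun y => v (y, t)) (xh (X, t)) (gVec xh α X t)) t := by
  have hdiff : Differentiable ℝ xh := hxh.differentiable two_ne_zero
  have hD : Differentiable ℝ (fderiv ℝ xh) :=
    (hxh.fderiv_right (m := 1) le_rfl).differentiable one_ne_zero
  set e : E2 := EuclideanSpace.single α 1
  have h1 : HasDerivAt (fun s => gVec xh α X s)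
      (fderiv ℝ (fderiv ℝ xh) (X, t) (0, 1) (e, 0)) t := by
    simp only [gVec_eq hdiff]
    exact (ContinuousLinearMap.apply ℝ E3 ((e, 0) : E2 × ℝ)).hasFDerivAt.comp_hasDerivAt t
      (hasDerivAt_time_slice (hD (X, t)))
  have hsymm : fderiv ℝ (fderiv ℝ xh) (X, t) (0, 1) (e, 0) =
      fderiv ℝ (fderiv ℝ xh) (X, t) (e, 0) (0, 1) :=
    (hxh.contDiffAt.isSymmSndFDerivAt (by simp)) _ _
  have h2 : HasFDerivAt (fun Y => fderiv ℝ xh (Y, t) (0, 1))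
      ((fderiv ℝ (fderiv ℝ xh) (X, t) ∘L ContinuousLinearMap.inl ℝ E2 ℝ).flip (0, 1)) X :=
    (ContinuousLinearMap.apply ℝ E3 ((0, 1) : E2 × ℝ)).hasFDerivAt.comp X
      (hasFDerivAt_slice (hD (X, t)))
  have h3 : HasFDerivAt (fun Y => v (xh (Y, t), t))
      (fderiv ℝ (fun y => v (y, t)) (xh (X, t)) ∘L fderiv ℝ (fun Y => xh (Y, t)) X) X :=
    HasFDerivAt.comp X (hasFDerivAt_slice
      (hv.differentiable one_ne_zero _)).differentiableAt.hasFDerivAt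
      (hasFDerivAt_slice (hdiff (X, t))).differentiableAt.hasFDerivAt
  have h4 : (fun Y => fderiv ℝ xh (Y, t) (0, 1)) =ᶠ[𝓝 X] fun Y => v (xh (Y, t), t) := by
    filter_upwards [hflow] with Y hY
    rw [← hY, (hasDerivAt_time_slice (hdiff (Y, t))).deriv]
  have h5 := congrArg (fun L : E2 →L[ℝ] E3 => L e) (h2.unique (h3.congr_of_eventuallyEq h4))
  convert h1 using 1
  rw [hsymm]
  exact h5.symm

theorem fderiv_slice_apply {f : E3 × ℝ → ℝ} (x : E3) (t : ℝ) (w : E3) :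
    fderiv ℝ (fun y => f (y, t)) x w = ∑ j, w j * pdx j f x t := by
  have hw : w = ∑ j, w j • EuclideanSpace.single j (1 : ℝ) := by
    simpa using ((EuclideanSpace.basisFun (Fin 3) ℝ).sum_repr w).symm
  conv_lhs => rw [hw]
  simp [pdx]

theorem fderiv_slice_apply_coord {v : E3 × ℝ → E3} (hv : Differentiable ℝ v) (x : E3) (t : ℝ)
    (w : E3) (i : Fin 3) :
    fderiv ℝ (fun y => v (y, t)) x w i = ∑ j, pdx j (fun p => v p i) x t * w j := by
  have h := ((EuclideanSpace.proj (𝕜 := ℝ) i).hasFDerivAt.comp x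
    (hasFDerivAt_slice (hv (x, t))).differentiableAt.hasFDerivAt).fderiv
  simp only [mul_comm _ (w _)]
  rw [← fderiv_slice_apply]
  exact (congrArg (fun L : E3 →L[ℝ] ℝ => L w) h).symm

/-- Liouville's formula for the Gram determinant of two vectors moved by a linear flow `M`. -/
theorem gram_derivative_identity (a b n : Fin 3 → ℝ) (M : Fin 3 → Fin 3 → ℝ)
    (h0 : n 0 = a 1 * b 2 - a 2 * b 1) (h1 : n 1 = a 2 * b 0 - a 0 * b 2)
    (h2 : n 2 = a 0 * b 1 - a 1 * b 0) :
    2 * (∑ i, (∑ j, M i j * a j) * a i) * (∑ i, b i * b i) +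
      2 * (∑ i, a i * a i) * (∑ i, (∑ j, M i j * b j) * b i) -
      2 * (∑ i, a i * b i) * (∑ i, ((∑ j, M i j * a j) * b i + a i * ∑ j, M i j * b j)) =
    2 * ((∑ i, n i * n i) * (∑ i, M i i) - ∑ j, ∑ i, n i * n j * M j i) := by
  simp only [Fin.sum_univ_three, h0, h1, h2]
  ring

theorem Gdet_eq_cross3 (xh : E2 × ℝ → E3) (X : E2) (t : ℝ) :
    Gdet xh X t = ‖cross3 (gVec xh 0 X t) (gVec xh 1 X t)‖ ^ 2 := by
  rw [EuclideanSpace.norm_sq_eq]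
  simp [Gdet, gMet, dot3, cross3, Fin.sum_univ_three]
  ring

theorem hasDerivAt_Gdet {xh : E2 × ℝ → E3} (hxh : ContDiff ℝ 2 xh) {v N : E3 × ℝ → E3}
    (hv : ContDiff ℝ 1 v) {X : E2} {t : ℝ}
    (hflow : ∀ᶠ Y in 𝓝 X, deriv (fun s => xh (Y, s)) t = v (xh (Y, t), t))
    (hG : 0 < Gdet xh X t) (hN : N (xh (X, t), t) = nHat xh X t) :
    HasDerivAt (fun s => Gdet xh X s) (2 * Gdet xh X t * sdiv N v (xh (X, t)) t) t := by
  have hcoord : ∀ α i, HasDerivAt (fun s => gVec xh α X s i)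
      (∑ j, pdx j (fun p => v p i) (xh (X, t)) t * gVec xh α X t j) t := fun α i => by
    rw [← fderiv_slice_apply_coord (hv.differentiable one_ne_zero)]
    exact (EuclideanSpace.proj (𝕜 := ℝ) i).hasFDerivAt.comp_hasDerivAt t
      (hasDerivAt_gVec hxh hv hflow α)
  have hmet : ∀ α β, HasDerivAt (fun s => gMet xh α β X s)
      (∑ i, ((∑ j, pdx j (fun p => v p i) (xh (X, t)) t * gVec xh α X t j) * gVec xh β X t i +
        gVec xh α X t i * ∑ j, pdx j (fun p => v p i) (xh (X, t)) t * gVec xh β X t j)) t :=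
    fun α β => by
      simp only [gMet, dot3]
      exact HasDerivAt.fun_sum fun i _ => (hcoord α i).fun_mul (hcoord β i)
  refine (((hmet 0 0).mul (hmet 1 1)).sub ((hmet 0 1).mul (hmet 1 0))).congr_deriv ?_
  set n := cross3 (gVec xh 0 X t) (gVec xh 1 X t) with hn
  have hGn : Gdet xh X t = ‖n‖ ^ 2 := Gdet_eq_cross3 xh X t
  have hNN : ∀ i j, Gdet xh X t * (N (xh (X, t), t) i * N (xh (X, t), t) j) = n i * n j := by
    intro i j
    have : ‖n‖ ≠ 0 := by
      rintro h
      simp [hGn, h] at hG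
    rw [hN, hGn, nHat, ← hn]
    simp only [PiLp.smul_apply, smul_eq_mul]
    field_simp
  have hsdiv : Gdet xh X t * sdiv N v (xh (X, t)) t =
      Gdet xh X t * (∑ i, pdx i (fun p => v p i) (xh (X, t)) t) -
        ∑ j, ∑ i, n i * n j * pdx i (fun p => v p j) (xh (X, t)) t := by
    simp only [← hNN, sdiv, tder, sub_mul, Finset.sum_sub_distrib, mul_sub, Finset.mul_sum,
      mul_assoc]
    simp
  have hid := gram_derivative_identity (gVec xh 0 X t) (gVec xh 1 X t) n
    (fun i j => pdx j (fun p => v p i) (xh (X, t)) t) (by simp [n, cross3]) (by simp [n, cross3])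
    (by simp [n, cross3])
  have hnn : ∑ i, n i * n i = Gdet xh X t := by
    rw [hGn, EuclideanSpace.norm_sq_eq]
    simp [sq]
  rw [mul_assoc, hsdiv]
  rw [hnn] at hid
  symm
  rw [← hid]
  simp only [gMet, dot3, Fin.sum_univ_three]
  ring

theorem hasDerivAt_comp_flow {xh : E2 × ℝ → E3} (hxh : Differentiable ℝ xh) {v : E3 × ℝ → E3}
    {f : E3 × ℝ → ℝ} (hf : Differentiable ℝ f) {X : E2} {t : ℝ}
    (hflow : deriv (fun s => xh (X, s)) t = v (xh (X, t), t)) :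
    HasDerivAt (fun s => f (xh (X, s), s)) (Dt v f (xh (X, t)) t) t := by
  have h1 : HasDerivAt (fun s => xh (X, s)) (v (xh (X, t), t)) t :=
    hflow ▸ (hasDerivAt_time_slice (hxh (X, t))).differentiableAt.hasDerivAt
  have h2 : HasDerivAt (fun s => f (xh (X, s), s))
      (fderiv ℝ f (xh (X, t), t) (v (xh (X, t), t), 1)) t :=
    (hf (xh (X, t), t)).hasFDerivAt.comp_hasDerivAt_of_eq t (h1.prodMk (hasDerivAt_id t)) rfl
  refine h2.congr_deriv ?_
  have hsplit : ((v (xh (X, t), t), 1) : E3 × ℝ) = (v (xh (X, t), t), 0) + (0, 1) := by simp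
  rw [hsplit, map_add, ← pdt_eq hf, Dt, add_comm, ← fderiv_slice_apply]
  simp [(hasFDerivAt_slice (hf (xh (X, t), t))).fderiv]

theorem hasDerivAt_sqrt_Gdet_mul {xh : E2 × ℝ → E3} (hxh : ContDiff ℝ 2 xh) {v N : E3 × ℝ → E3}
    (hv : ContDiff ℝ 1 v) {f : E3 × ℝ → ℝ} (hf : Differentiable ℝ f) {X : E2} {t : ℝ}
    (hflow : ∀ᶠ Y in 𝓝 X, deriv (fun s => xh (Y, s)) t = v (xh (Y, t), t))
    (hG : 0 < Gdet xh X t) (hN : N (xh (X, t), t) = nHat xh X t) :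
    HasDerivAt (fun s => √(Gdet xh X s) * f (xh (X, s), s))
      (√(Gdet xh X t) *
        (Dt v f (xh (X, t)) t + sdiv N v (xh (X, t)) t * f (xh (X, t), t))) t := by
  have h1 := (hasDerivAt_Gdet hxh hv hflow hG hN).sqrt hG.ne'
  have h2 := hasDerivAt_comp_flow (hxh.differentiable two_ne_zero) hf hflow.self_of_nhds
  refine (h1.mul h2).congr_deriv ?_
  have h3 : √(Gdet xh X t) ≠ 0 := (Real.sqrt_pos.2 hG).ne'
  have h4 : √(Gdet xh X t) ^ 2 = Gdet xh X t := Real.sq_sqrt hG.le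
  field_simp
  rw [h4]
  ring

end SurfaceCalculus

/-- the surface transport theorem:
`d/dt ∫_{Ω(t)} f dH² = ∫_{Ω(t)} (D_t f + (div_Γ v) f) dH²`. -/
theorem surface_transport_theorem
    (T : ℝ) (hT : 0 < T)
    (U : Set E2) (hUopen : IsOpen U) (hUne : U.Nonempty) (hUbd : Bornology.IsBounded U)
    (xh : E2 × ℝ → E3) (hxh : ContDiff ℝ 2 xh)
    (lam : ℝ) (hlam : 0 < lam)
    (hG : ∀ X ∈ U, ∀ t ∈ Set.Ico (0 : ℝ) T, lam ≤ Gdet xh X t)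
    (hinj : ∀ t ∈ Set.Ico (0 : ℝ) T, Set.InjOn (fun X => xh (X, t)) U)
    (N : E3 × ℝ → E3) (hN : ContDiff ℝ 1 N)
    (hNs : ∀ X ∈ U, ∀ t ∈ Set.Ico (0 : ℝ) T, N (xh (X, t), t) = nHat xh X t)
    (v : E3 × ℝ → E3) (hv : ContDiff ℝ 2 v)
    (hflow : ∀ X ∈ U, ∀ t ∈ Set.Ico (0 : ℝ) T,
      deriv (fun s => xh (X, s)) t = v (xh (X, t), t))
    (f : E3 × ℝ → ℝ) (hf : ContDiff ℝ 1 f) :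
    ∀ V : Set E2, MeasurableSet V → V ⊆ U → ∀ t ∈ Set.Ioo (0 : ℝ) T,
      HasDerivAt (fun s => ∫ x in (fun X => xh (X, s)) '' V, f (x, s) ∂(μH[2] : Measure E3))
        (∫ x in (fun X => xh (X, t)) '' V,
          (Dt v f x t + sdiv N v x t * f (x, t)) ∂(μH[2] : Measure E3)) t := by
  intro V hV hVU t ht
  have hxh1 : ContDiff ℝ 1 xh := hxh.of_le one_le_two
  have hv1 : ContDiff ℝ 1 v := hv.of_le one_le_two
  have hpos : ∀ s ∈ Set.Ico (0 : ℝ) T, ∀ X ∈ U, 0 < Gdet xh X s :=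
    fun s hs X hX => hlam.trans_le (hG X hX s hs)
  have harea : ∀ s ∈ Set.Ico (0 : ℝ) T, ∀ g : E3 → ℝ,
      ∫ x in (fun X => xh (X, s)) '' V, g x ∂(μH[2] : Measure E3) =
        ∫ X in V, √(Gdet xh X s) * g (xh (X, s)) ∂(μH[2] : Measure E2) :=
    fun s hs g => surface_integral_eq hxh hUopen hV hVU (hpos s hs) (hinj s hs) g
  rw [harea t (Set.Ioo_subset_Ico_self ht)]
  have hev : (fun s => ∫ x in (fun X => xh (X, s)) '' V, f (x, s) ∂(μH[2] : Measure E3)) =ᶠ[nhds t]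
      fun s => ∫ X in V, √(Gdet xh X s) * f (xh (X, s), s) ∂(μH[2] : Measure E2) := by
    filter_upwards [isOpen_Ioo.mem_nhds ht] with s hs
    exact harea s (Set.Ioo_subset_Ico_self hs) _
  refine HasDerivAt.congr_of_eventuallyEq ?_ hev
  have hflowmap : Continuous fun p : E2 × ℝ => (xh p, p.2) :=
    hxh.continuous.prodMk continuous_snd
  have hF : Continuous fun p : E2 × ℝ => √(Gdet xh p.1 p.2) * f (xh p, p.2) :=
    (continuous_Gdet hxh1).sqrt.mul (hf.continuous.comp hflowmap)
  have hF' : Continuous fun p : E2 × ℝ => √(Gdet xh p.1 p.2) *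
      (Dt v f (xh p) p.2 + sdiv N v (xh p) p.2 * f (xh p, p.2)) :=
    (continuous_Gdet hxh1).sqrt.mul (((continuous_Dt hv.continuous hf).comp hflowmap).add
      (((continuous_sdiv hN.continuous hv1).comp hflowmap).mul (hf.continuous.comp hflowmap)))
  obtain ⟨a, b, hab, hmem, habT⟩ :=
    exists_Icc_mem_subset_of_mem_nhds (isOpen_Ioo.mem_nhds ht)
  have hcompact : IsCompact (closure U) := hUbd.isCompact_closure
  obtain ⟨C, hC⟩ := (hcompact.prod (isCompact_Icc (a := a) (b := b))).exists_bound_of_continuousOn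
    hF'.continuousOn
  have hhaar : (μH[2] : Measure E2).IsAddHaarMeasure := hausdorffMeasure_two_isAddHaarMeasure
  have hslice : ∀ s : ℝ, Continuous fun X : E2 => (X, s) := fun s =>
    continuous_id.prodMk continuous_const
  refine (hasDerivAt_integral_of_dominated_loc_of_deriv_le (bound := fun _ => C)
    (F' := fun s X => √(Gdet xh X s) *
      (Dt v f (xh (X, s)) s + sdiv N v (xh (X, s)) s * f (xh (X, s), s))) hmem
    (Filter.Eventually.of_forall fun s => (hF.comp (hslice s)).aestronglyMeasurable)
    ?_ (hF'.comp (hslice t)).aestronglyMeasurable ?_ ?_ ?_).2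
  · exact ((hF.comp (hslice t)).continuousOn.integrableOn_compact hcompact).mono_set
      (hVU.trans subset_closure)
  · filter_upwards [ae_restrict_mem hV] with X hX s hs
    exact hC (X, s) ⟨subset_closure (hVU hX), hs⟩
  · exact integrableOn_const ((hUbd.subset hVU).measure_lt_top).ne
  · filter_upwards [ae_restrict_mem hV] with X hX s hs
    have hsT := Set.Ioo_subset_Ico_self (habT hs)
    refine hasDerivAt_sqrt_Gdet_mul hxh hv1 (hf.differentiable one_ne_zero) ?_
      (hpos s hsT X (hVU hX)) (hNs X (hVU hX) s hsT)
    filter_upwards [hUopen.mem_nhds (hVU hX)] with Y hY using hflow Y hY s hsT
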